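/- Let u ∈ ℝ with 0 ≤ u < 2/3, and set z = u·(u-2)². Then ∑_{n ≥ 1} (1/n)·binomial(3n-2, n-1)·(1/2^{3n-1})·zⁿ = u. -/

import Mathlib

/-- Ballot (Raney) numbers. -/
def bal : ℕ → ℕ → ℕ
  | 0, _ => 1
  | _ + 1, 0 => 0
  | n + 1, m + 1 => bal (n + 1) m + bal n (m + 3)

lemma bal_zero (m : ℕ) : bal 0 m = 1 := by simp [bal]
lemma bal_succ_zero (n : ℕ) : bal (n + 1) 0 = 0 := by simp [bal]
lemma bal_succ_succ (n m : ℕ) : bal (n + 1) (m + 1) = bal (n + 1) m + bal n (m + 3) := by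
  rw [bal]

lemma bal_closed (n : ℕ) : ∀ m : ℕ,
    bal n (m + 1) * n.factorial * (2 * n + m + 1).factorial
      = (m + 1) * (3 * n + m).factorial := by
  induction n with
  | zero => intro m; simp [bal_zero, Nat.factorial_succ]
  | succ n ih =>
    intro m
    induction m with
    | zero =>
      have h := ih 2
      rw [bal_succ_succ, bal_succ_zero]
      rw [show 2 * (n + 1) + 0 + 1 = 2 * n + 2 + 1 by ring,
        show 3 * (n + 1) + 0 = (3 * n + 2) + 1 by ring, Nat.factorial_succ n,
        Nat.factorial_succ (3 * n + 2)]
      simp only [zero_add] at *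
      linear_combination (n + 1) * h
    | succ m ihm =>
      have h := ih (m + 3)
      rw [bal_succ_succ]
      rw [show 2 * (n + 1) + m + 1 = 2 * n + m + 3 by ring,
        show 3 * (n + 1) + m = 3 * n + m + 3 by ring] at ihm
      rw [show 2 * n + (m + 3) + 1 = (2 * n + m + 3) + 1 by ring,
        show 3 * n + (m + 3) = 3 * n + m + 3 by ring,
        Nat.factorial_succ (2 * n + m + 3)] at h
      rw [show 2 * (n + 1) + (m + 1) + 1 = (2 * n + m + 3) + 1 by ring,
        show 3 * (n + 1) + (m + 1) = (3 * n + m + 3) + 1 by ring,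
        Nat.factorial_succ (2 * n + m + 3), Nat.factorial_succ (3 * n + m + 3)]
      rw [Nat.factorial_succ n] at *
      rw [show m + 1 + 3 = m + 3 + 1 by ring]
      linear_combination (2 * n + m + 4) * ihm + (n + 1) * h

lemma bal_two (k : ℕ) : bal k 2 * (k + 1) = Nat.choose (3 * k + 1) k := by
  have h := bal_closed k 1
  have h2 := Nat.choose_mul_factorial_mul_factorial (show k ≤ 3 * k + 1 by omega)
  rw [show 3 * k + 1 - k = 2 * k + 1 by omega] at h2
  rw [Nat.factorial_succ (2 * k + 1), ← h2] at h
  have p : 0 < 2 * k.factorial * (2 * k + 1).factorial := by positivity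
  apply Nat.eq_of_mul_eq_mul_right p
  linear_combination h

lemma partial_rec (x : ℝ) (N m : ℕ) :
    ∑ n ∈ Finset.range (N + 1), (bal n (m + 1) : ℝ) * x ^ n
      = ∑ n ∈ Finset.range (N + 1), (bal n m : ℝ) * x ^ n
        + x * ∑ n ∈ Finset.range N, (bal n (m + 3) : ℝ) * x ^ n := by
  rw [Finset.sum_range_succ', Finset.sum_range_succ', Finset.mul_sum]
  simp only [bal_succ_succ, bal_zero, Nat.cast_add]
  have : ∀ n : ℕ, ((bal (n + 1) m : ℝ) + bal n (m + 3)) * x ^ (n + 1)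
      = (bal (n + 1) m : ℝ) * x ^ (n + 1) + x * ((bal n (m + 3) : ℝ) * x ^ n) := by
    intro n; ring
  simp only [this, Finset.sum_add_distrib]
  ring

lemma partial_bound (t : ℝ) (h0 : 0 ≤ t) (h1 : t < 1) (N : ℕ) : ∀ m : ℕ,
    (∑ n ∈ Finset.range N, (bal n m : ℝ) * (t * (1 - t) ^ 2) ^ n) * (1 - t) ^ m ≤ 1 := by
  induction N with
  | zero => intro m; simp
  | succ N ih =>
    intro m
    induction m with
    | zero =>
      rw [Finset.sum_range_succ']
      simp [bal_succ_zero, bal_zero]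
    | succ m ihm =>
      rw [partial_rec]
      have h := ih (m + 3)
      have a := mul_le_mul_of_nonneg_left h h0
      have b := mul_le_mul_of_nonneg_left ihm (by linarith : 0 ≤ 1 - t)
      calc _ = _ := by ring
        _ ≤ _ := add_le_add b a
        _ = 1 := by ring

lemma harmonic_const (t : ℝ) (h0 : 0 ≤ t) (h1 : t < 1 / 3) (G : ℕ → ℝ)
    (hG0 : ∀ m, 0 ≤ G m) (hG1 : ∀ m, G m ≤ 1)
    (hr : ∀ m, G (m + 1) = (1 - t) * G m + t * G (m + 3)) (m : ℕ) : G m = G 0 := by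
  have key : ∀ k m : ℕ, |G (m + 1) - G m| ≤ (3 * t) ^ k := by
    intro k
    induction k with
    | zero =>
      intro m
      rw [pow_zero, abs_le]
      constructor <;> linarith [hG0 m, hG1 m, hG0 (m + 1), hG1 (m + 1)]
    | succ k ih =>
      intro m
      have e : G (m + 1) - G m = t * ((G (m + 3) - G (m + 2)) + (G (m + 2) - G (m + 1))
          + (G (m + 1) - G m)) := by linear_combination hr m
      rw [e, abs_mul, abs_of_nonneg h0, pow_succ]
      have a := abs_add_three (G (m + 3) - G (m + 2)) (G (m + 2) - G (m + 1)) (G (m + 1) - G m)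
      have := ih m
      have := ih (m + 1)
      have := ih (m + 2)
      have := mul_le_mul_of_nonneg_left (show |G (m + 3) - G (m + 2) + (G (m + 2) - G (m + 1))
          + (G (m + 1) - G m)| ≤ 3 * (3 * t) ^ k by linarith) h0
      linarith
  have step : ∀ m, G (m + 1) = G m := by
    intro m
    have l := tendsto_pow_atTop_nhds_zero_of_lt_one (by linarith : 0 ≤ 3 * t) (by linarith)
    have := ge_of_tendsto' l (fun k => key k m)
    exact sub_eq_zero.mp (abs_nonpos_iff.mp this)
  induction m with
  | zero => rfl
  | succ m ih => rw [step, ih]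

lemma bal_hasSum (t : ℝ) (h0 : 0 ≤ t) (h1 : t < 1 / 3) (m : ℕ) :
    Summable (fun n => (bal n m : ℝ) * (t * (1 - t) ^ 2) ^ n) ∧
    (∑' n, (bal n m : ℝ) * (t * (1 - t) ^ 2) ^ n) * (1 - t) ^ m = 1 := by
  set x := t * (1 - t) ^ 2 with hx
  have hq : 0 < 1 - t := by linarith
  have hx0 : 0 ≤ x := by positivity
  have nn : ∀ m n : ℕ, 0 ≤ (bal n m : ℝ) * x ^ n := fun m n => by positivity
  have S : ∀ m, Summable (fun n => (bal n m : ℝ) * x ^ n) := by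
    intro m
    refine summable_of_sum_range_le (c := 1 / (1 - t) ^ m) (nn m) ?_
    intro N
    rw [le_div_iff₀ (by positivity)]
    exact partial_bound t h0 (by linarith) N m
  refine ⟨S m, ?_⟩
  have G0 : (∑' n, (bal n 0 : ℝ) * x ^ n) * (1 - t) ^ 0 = 1 := by
    rw [(S 0).tsum_eq_zero_add]
    simp [bal_succ_zero, bal_zero]
  have := harmonic_const t h0 h1 (fun m => (∑' n, (bal n m : ℝ) * x ^ n) * (1 - t) ^ m)
    (fun m => mul_nonneg (tsum_nonneg (nn m)) (by positivity))
    (fun m => by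
      have : (∑' n, (bal n m : ℝ) * x ^ n) ≤ 1 / (1 - t) ^ m := by
        refine (S m).tsum_le_of_sum_range_le ?_
        intro N
        rw [le_div_iff₀ (by positivity)]
        exact partial_bound t h0 (by linarith) N m
      rwa [le_div_iff₀ (by positivity)] at this)
    (fun m => by
      have e : (∑' n, (bal n (m + 1) : ℝ) * x ^ n)
          = (∑' n, (bal n m : ℝ) * x ^ n) + x * ∑' n, (bal n (m + 3) : ℝ) * x ^ n := by
        have l1 := ((S (m + 1)).hasSum.tendsto_sum_nat).comp (Filter.tendsto_add_atTop_nat 1)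
        have l2 := ((S m).hasSum.tendsto_sum_nat).comp (Filter.tendsto_add_atTop_nat 1)
        have l3 := ((S (m + 3)).hasSum.tendsto_sum_nat).const_mul x
        refine tendsto_nhds_unique l1 ((l2.add l3).congr ?_)
        intro N
        exact (partial_rec x N m).symm
      simp only [e]
      rw [hx]
      ring) m
  rw [this, G0]

theorem inverse_series_sums_to_u (u : ℝ) (hu0 : 0 ≤ u) (hu : u < 2 / 3) :
    ∑' n : ℕ,
      (1 / (n : ℝ)) * (Nat.choose (3 * n - 2) (n - 1) : ℝ) *
        (1 / 2 ^ (3 * n - 1)) * (u * (u - 2) ^ 2) ^ n = u := by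
  obtain ⟨S, H⟩ := bal_hasSum (u / 2) (by linarith) (by linarith) 2
  have e : ∀ k : ℕ, (1 / ((k + 1 : ℕ) : ℝ)) * (Nat.choose (3 * (k + 1) - 2) (k + 1 - 1) : ℝ) *
        (1 / 2 ^ (3 * (k + 1) - 1)) * (u * (u - 2) ^ 2) ^ (k + 1)
      = (u * (1 - u / 2) ^ 2) * ((bal k 2 : ℝ) * (u / 2 * (1 - u / 2) ^ 2) ^ k) := by
    intro k
    rw [show 3 * (k + 1) - 2 = 3 * k + 1 by omega, show k + 1 - 1 = k by omega,
      show 3 * (k + 1) - 1 = 3 * k + 2 by omega, ← bal_two]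
    rw [show u * (u - 2) ^ 2 = 8 * (u / 2 * (1 - u / 2) ^ 2) by ring, mul_pow, pow_succ _ k,
      pow_succ _ k, pow_add, pow_mul]
    push_cast
    have : (k : ℝ) + 1 ≠ 0 := by positivity
    norm_num
    field_simp
    ring
  have S' := S.mul_left (u * (1 - u / 2) ^ 2)
  rw [Summable.tsum_eq_zero_add ((summable_nat_add_iff 1).mp (by simpa only [e] using S'))]
  simp only [e]
  rw [tsum_mul_left]
  simp only [Nat.cast_zero, div_zero, zero_mul, zero_add]
  linear_combination u * H
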